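/- Let G be a simple graph on n ≥ 3 vertices with s ≥ 3 edges whose girth (the length of a shortest cycle of G) is g, let m ∈ ℕ, and let H be a full m-fold cover of G. If e_{i_1}, …, e_{i_g} are g distinct edges of G that are not the edge set of a cycle of length g in G, then the number of transversals I of H with I ∈ S_{e_{i_1}} ∩ ⋯ ∩ S_{e_{i_g}} equals m^{n−g}. -/

import Mathlib

/-- `H` is a full `m`-fold cover of `G`, on vertex set `V(G) × Fin m` with fiber
`{u} × Fin m` over `u`: fibers induce complete graphs, the cross-edges over each edge
of `G` form a perfect matching, and there are no other edges. -/
def IsFullCover {V : Type} (G : SimpleGraph V) (m : ℕ)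
    (H : SimpleGraph (V × Fin m)) : Prop :=
  (∀ u : V, ∀ i j : Fin m, H.Adj (u, i) (u, j) ↔ i ≠ j) ∧
  (∀ u v : V, u ≠ v → ¬ G.Adj u v → ∀ i j : Fin m, ¬ H.Adj (u, i) (v, j)) ∧
  (∀ u v : V, G.Adj u v → ∀ i : Fin m, ∃! j : Fin m, H.Adj (u, i) (v, j))

/-- The number of transversals `I` of `H` (sets picking exactly one vertex from each
fiber, i.e. graphs of functions `f : V → Fin m`) such that for each edge `uv ∈ E`, the
subgraph of `H` induced by `I` contains an edge joining the fibers of `u` and `v`;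
that is, the number of elements of `⋂_{e ∈ E} S_e`. -/
noncomputable def coveredCount {V : Type} (m : ℕ) (H : SimpleGraph (V × Fin m))
    (E : Finset (Sym2 V)) : ℕ :=
  Nat.card {f : V → Fin m // ∀ e ∈ E, ∀ u v : V, e = s(u, v) → H.Adj (u, f u) (v, f v)}

open SimpleGraph in
/-- A finite acyclic graph with an edge has a vertex with exactly one neighbour. -/
theorem SimpleGraph.IsAcyclic.exists_leaf {V : Type*} [Finite V] {F : SimpleGraph V}
    (hF : F.IsAcyclic) (hne : F ≠ ⊥) : ∃ u v, F.Adj u v ∧ ∀ w, F.Adj u w → w = v := by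
  classical
  have := Fintype.ofFinite V
  obtain ⟨a, b, hab⟩ := ne_bot_iff_exists_adj.mp hne
  let S : Set ℕ := {k | ∃ (x y : V) (p : F.Walk x y), p.IsPath ∧ p.length = k}
  have hfin : S.Finite := (Set.finite_lt_nat (Fintype.card V)).subset <| by
    rintro _ ⟨x, y, p, hp, rfl⟩
    exact hp.length_lt
  have hS1 : 1 ∈ S := ⟨a, b, hab.toWalk, by simp [hab.ne], rfl⟩
  obtain ⟨k, ⟨x, y, p, hp, rfl⟩, hmax⟩ := hfin.exists_maximal ⟨1, hS1⟩
  have hpos : 1 ≤ p.length := by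
    by_contra h
    exact h (hmax hS1 (by lia))
  have hnil : ¬ p.Nil := by
    rw [← Walk.length_eq_zero_iff]
    lia
  refine ⟨x, p.snd, p.adj_snd hnil, fun w hw ↦ ?_⟩
  by_cases hmem : w ∈ p.support
  · exact hF.eq_snd_of_adj_start hp hw hmem
  · have := hmax (y := p.length + 1) ⟨w, y, .cons hw.symm p, hp.cons hmem, rfl⟩ (by lia)
    lia

/-- A finite acyclic graph on a nonempty vertex set has fewer edges than vertices. -/
theorem SimpleGraph.IsAcyclic.ncard_edgeSet_lt {V : Type*} [Finite V] [Nonempty V]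
    {F : SimpleGraph V} (hF : F.IsAcyclic) : F.edgeSet.ncard < Nat.card V := by
  obtain ⟨T, hle, -, hT⟩ :=
    SimpleGraph.connected_top.exists_isTree_le_of_le_of_isAcyclic le_top hF
  have h := (SimpleGraph.isTree_iff_connected_and_card.mp hT).2
  have h' := Set.ncard_le_ncard (SimpleGraph.edgeSet_mono hle) T.edgeSet.toFinite
  rw [Nat.card_coe_set_eq] at h
  lia

/-- Deleting a pendant edge multiplies the number of covered transversals by `m`. -/
theorem coveredCount_mul_eq_coveredCount_erase {V : Type} [DecidableEq V]
    {G : SimpleGraph V} {m : ℕ} {H : SimpleGraph (V × Fin m)} (hH : IsFullCover G m H)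
    {E : Finset (Sym2 V)} {u v : V} (huv : G.Adj u v) (he : s(u, v) ∈ E)
    (hleaf : ∀ w, s(u, w) ∈ E → w = v) :
    coveredCount m H E * m = coveredCount m H (E.erase s(u, v)) := by
  choose σ hσ hσ' using fun i ↦ hH.2.2 v u huv.symm i
  have hvu : v ≠ u := huv.ne'
  have hsolve (f : V → Fin m)
      (hf : ∀ e ∈ E, ∀ x y : V, e = s(x, y) → H.Adj (x, f x) (y, f y)) : σ (f v) = f u :=
    (hσ' (f v) (f u) (hf _ he v u Sym2.eq_swap)).symm
  have hoff {x y : V} (h : s(x, y) ∈ E.erase s(u, v)) : x ≠ u ∧ y ≠ u := by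
    obtain ⟨hne, hE⟩ := Finset.mem_erase.mp h
    constructor
    · rintro rfl
      exact hne (by rw [hleaf y hE])
    · rintro rfl
      rw [Sym2.eq_swap] at hE
      exact hne (by rw [hleaf x hE, Sym2.eq_swap])
  let equiv : {f : V → Fin m // ∀ e ∈ E, ∀ x y : V, e = s(x, y) → H.Adj (x, f x) (y, f y)}
        × Fin m ≃
      {f : V → Fin m // ∀ e ∈ E.erase s(u, v), ∀ x y : V, e = s(x, y) →
        H.Adj (x, f x) (y, f y)} :=
    { toFun := fun p ↦ ⟨Function.update p.1.1 u p.2, by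
        rintro _ he x y rfl
        obtain ⟨hx, hy⟩ := hoff he
        rw [Function.update_of_ne hx, Function.update_of_ne hy]
        exact p.1.2 _ (Finset.mem_of_mem_erase he) x y rfl⟩
      invFun := fun f ↦ (⟨Function.update f.1 u (σ (f.1 v)), by
        rintro _ he x y rfl
        by_cases hxy : s(x, y) = s(u, v)
        · rcases Sym2.eq_iff.mp hxy with ⟨rfl, rfl⟩ | ⟨rfl, rfl⟩
          · rw [Function.update_self, Function.update_of_ne hvu]
            exact (hσ _).symm
          · rw [Function.update_self, Function.update_of_ne hvu]
            exact hσ _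
        · have he' := Finset.mem_erase.mpr ⟨hxy, he⟩
          obtain ⟨hx, hy⟩ := hoff he'
          rw [Function.update_of_ne hx, Function.update_of_ne hy]
          exact f.2 _ he' x y rfl⟩, f.1 u)
      left_inv := by
        rintro ⟨⟨f, hf⟩, i⟩
        simp [Function.update_of_ne hvu, hsolve f hf]
      right_inv := by
        rintro ⟨f, hf⟩
        simp }
  rw [coveredCount, coveredCount, ← Nat.card_congr equiv, Nat.card_prod, Nat.card_fin]

/-- The number of transversals covered along every edge of a forest. -/
theorem coveredCount_mul_pow_card {V : Type} [Fintype V] [DecidableEq V]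
    {G : SimpleGraph V} {m : ℕ} {H : SimpleGraph (V × Fin m)} (hH : IsFullCover G m H)
    (E : Finset (Sym2 V)) (hE : ↑E ⊆ G.edgeSet)
    (hac : (SimpleGraph.fromEdgeSet (E : Set (Sym2 V))).IsAcyclic) :
    coveredCount m H E * m ^ E.card = m ^ Fintype.card V := by
  induction hk : E.card generalizing E with
  | zero =>
    obtain rfl := Finset.card_eq_zero.mp hk
    simp [coveredCount]
  | succ k ih =>
    have hdiag {x y : V} (h : s(x, y) ∈ E) : G.Adj x y := hE h
    have hne : SimpleGraph.fromEdgeSet (E : Set (Sym2 V)) ≠ ⊥ := by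
      obtain ⟨e, he⟩ := Finset.card_pos.mp (by lia : 0 < E.card)
      induction e with
      | h x y =>
        exact SimpleGraph.ne_bot_iff_exists_adj.mpr
          ⟨x, y, (SimpleGraph.fromEdgeSet_adj _).mpr ⟨he, (hdiag he).ne⟩⟩
    obtain ⟨u, v, huv, hleaf⟩ := hac.exists_leaf hne
    have he : s(u, v) ∈ E := ((SimpleGraph.fromEdgeSet_adj _).mp huv).1
    have hsub : (↑(E.erase s(u, v)) : Set (Sym2 V)) ⊆ E :=
      Finset.coe_subset.mpr (E.erase_subset _)
    have hstep := coveredCount_mul_eq_coveredCount_erase hH (hdiag he) he fun w hw ↦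
      hleaf w ((SimpleGraph.fromEdgeSet_adj _).mpr ⟨hw, (hdiag hw).ne⟩)
    rw [pow_succ', ← mul_assoc, hstep]
    refine ih _ (hsub.trans hE) (hac.anti (SimpleGraph.fromEdgeSet_mono hsub)) ?_
    rw [Finset.card_erase_of_mem he, hk, Nat.add_sub_cancel]

/-- A set of `g` edges of a graph of girth `g` that is not the edge set of a `g`-cycle
spans a forest. -/
theorem SimpleGraph.isAcyclic_fromEdgeSet_of_card_eq_egirth {V : Type*} [DecidableEq V]
    {G : SimpleGraph V} {g : ℕ} (hgirth : G.egirth = (g : ℕ∞)) {E : Finset (Sym2 V)}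
    (hE : ↑E ⊆ G.edgeSet) (hEcard : E.card = g)
    (hnotcyc : ¬ ∃ (v : V) (c : G.Walk v v), c.IsCycle ∧ c.length = g ∧
      c.edges.toFinset = E) :
    (SimpleGraph.fromEdgeSet (E : Set (Sym2 V))).IsAcyclic := by
  intro v c hc
  have hle : SimpleGraph.fromEdgeSet (E : Set (Sym2 V)) ≤ G := fun x y h ↦
    hE ((SimpleGraph.fromEdgeSet_adj _).mp h).1
  have hsub : c.edges.toFinset ⊆ E := fun e he ↦ by
    have := c.edges_subset_edgeSet (List.mem_toFinset.mp he)
    rw [SimpleGraph.edgeSet_fromEdgeSet] at this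
    exact this.1
  have hcard : c.edges.toFinset.card = c.length := by
    rw [List.toFinset_card_of_nodup hc.edges_nodup, SimpleGraph.Walk.length_edges]
  have hlen : g ≤ c.length := by
    have := SimpleGraph.egirth_le_length (hc.mapLe hle)
    rw [hgirth, SimpleGraph.Walk.length_mapLe] at this
    exact_mod_cast this
  have heq : c.edges.toFinset = E := Finset.eq_of_subset_of_card_le hsub (by lia)
  refine hnotcyc ⟨v, c.mapLe hle, hc.mapLe hle, ?_, ?_⟩
  · rw [SimpleGraph.Walk.length_mapLe, ← hcard, heq, hEcard]
  · rw [SimpleGraph.Walk.edges_mapLe_eq_edges, heq]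

theorem stmt6 {V : Type} [Fintype V] [DecidableEq V] (G : SimpleGraph V) (n sG g : ℕ)
    (hn : Fintype.card V = n) (hsG : G.edgeSet.ncard = sG)
    (hn3 : 3 ≤ n) (hs3 : 3 ≤ sG) (hgirth : G.egirth = (g : ℕ∞))
    (m : ℕ) (H : SimpleGraph (V × Fin m)) (hH : IsFullCover G m H)
    (E : Finset (Sym2 V)) (hE : ↑E ⊆ G.edgeSet) (hEcard : E.card = g)
    (hnotcyc : ¬ ∃ (v : V) (c : G.Walk v v), c.IsCycle ∧ c.length = g ∧
      c.edges.toFinset = E) :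
    coveredCount m H E = m ^ (n - g) := by
  have hac := SimpleGraph.isAcyclic_fromEdgeSet_of_card_eq_egirth hgirth hE hEcard hnotcyc
  have hcount := coveredCount_mul_pow_card hH E hE hac
  rw [hEcard, hn] at hcount
  have : Nonempty V := Fintype.card_pos_iff.mp (by lia)
  have hlt : g < n := by
    have h := hac.ncard_edgeSet_lt
    have hdiag : (E : Set (Sym2 V)) \ Sym2.diagSet = E :=
      sdiff_eq_left.mpr (Set.disjoint_left.mpr fun e he hd ↦
        G.not_isDiag_of_mem_edgeSet (hE he) hd)
    rwa [SimpleGraph.edgeSet_fromEdgeSet, hdiag, Set.ncard_coe_finset, hEcard,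
      Nat.card_eq_fintype_card, hn] at h
  obtain rfl | hm := Nat.eq_zero_or_pos m
  · rw [zero_pow (by lia), coveredCount]
    exact Nat.card_eq_zero.mpr (.inl ⟨fun f ↦ (f.1 (Classical.arbitrary V)).elim0⟩)
  · refine Nat.eq_of_mul_eq_mul_right (pow_pos hm g) ?_
    rw [hcount, ← pow_add, Nat.sub_add_cancel hlt.le]
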